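/- Let r_i = (ξ_i, t_i), i = 1,…,n, be i.i.d. with ξ_i ∼ N(0,1) independent of t_i uniform on Δ, and consider the degenerate U-statistic B_n = (1/n) Σ_{1≤i<k≤n} W_n(r_i, r_k) with kernel W_n(r', r'') = ξ'ξ'' Σ_{l∈𝓝} a_l² φ_l(t')φ_l(t''). Under the stated assumptions, B_n is asymptotically Gaussian N(0, u_n²) with u_n² = ½ Σ_{l∈𝓝} a_l⁴. (Proposition 7.1.) -/

import Mathlib

open MeasureTheory ProbabilityTheory Filter
open scoped BigOperators Topology

noncomputable section
/-- The uniform probability measure on the cube Δ = [0,1]^d. -/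
def uniformCube (d : ℕ) : Measure (Fin d → ℝ) :=
  volume.restrict (Set.Icc (0 : Fin d → ℝ) 1)

/-- Joint law of the i.i.d. pairs r_i = (t_i, ξ_i), i = 1,…,n. -/
def designNoiseLaw (d n : ℕ) : Measure ((Fin n → (Fin d → ℝ)) × (Fin n → ℝ)) :=
  (Measure.pi fun _ : Fin n => uniformCube d).prod
    (Measure.pi fun _ : Fin n => gaussianReal 0 1)

/-- The degenerate U-statistic
B_n = (1/n) Σ_{1≤i<k≤n} ξ_i ξ_k Σ_{l∈𝓝} a_l² φ_l(t_i) φ_l(t_k). -/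
def Bstat {d : ℕ} {ι : Type*} [Fintype ι] (φ : ι → (Fin d → ℝ) → ℝ) (a : ι → ℝ)
    (n : ℕ) (ω : (Fin n → (Fin d → ℝ)) × (Fin n → ℝ)) : ℝ :=
  (1 / (n : ℝ)) * ∑ i : Fin n, ∑ k ∈ Finset.Ioi i,
    ω.2 i * ω.2 k * ∑ l, (a l) ^ 2 * φ l (ω.1 i) * φ l (ω.1 k)

/-- The standard Gaussian cumulative distribution function Φ. -/
def stdGaussCDF (x : ℝ) : ℝ := (gaussianReal 0 1 (Set.Iic x)).toReal

/-- a_n ≍ b_n : there are constants 0 < c₁ ≤ c₂ < ∞ with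
c₁ b_n ≤ a_n ≤ c₂ b_n for all large n. -/
def Asymp (A B : ℕ → ℝ) : Prop :=
  ∃ c₁ c₂ : ℝ, 0 < c₁ ∧ 0 < c₂ ∧ ∀ᶠ n in atTop, c₁ * B n ≤ A n ∧ A n ≤ c₂ * B n

lemma gauss_sq : ∫ x, x ^ 2 ∂(gaussianReal 0 1) = 1 := by
  have h := variance_fun_id_gaussianReal (μ := 0) (v := 1)
  rw [variance_eq_integral measurable_id'.aemeasurable] at h
  simpa using h

lemma gauss_four : ∫ x, x ^ 4 ∂(gaussianReal 0 1) = 3 := by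
  have h : ∫ ω, ω ^ 4 ∂(gaussianReal 0 1)
      = iteratedDeriv 4 (mgf (fun x ↦ x) (gaussianReal 0 1)) 0 := by
    rw [iteratedDeriv_mgf_zero] <;> simp
  rw [h, mgf_fun_id_gaussianReal]
  have e0 : ∀ t : ℝ, HasDerivAt (fun t : ℝ => Real.exp (t ^ 2 / 2)) (t * Real.exp (t ^ 2 / 2)) t := by
    intro t
    have := ((hasDerivAt_pow 2 t).div_const 2).exp
    convert this using 1
    simp; ring
  have h1 : deriv (fun t : ℝ => Real.exp (t ^ 2 / 2)) = fun t => t * Real.exp (t ^ 2 / 2) :=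
    funext fun t => (e0 t).deriv
  have h2 : deriv (fun t : ℝ => t * Real.exp (t ^ 2 / 2))
      = fun t => (1 + t ^ 2) * Real.exp (t ^ 2 / 2) := by
    funext t
    have := ((hasDerivAt_id t).mul (e0 t)).deriv
    simp only [id] at this
    refine this.trans ?_
    ring
  have h3 : deriv (fun t : ℝ => (1 + t ^ 2) * Real.exp (t ^ 2 / 2))
      = fun t => (3 * t + t ^ 3) * Real.exp (t ^ 2 / 2) := by
    funext t
    have := ((((hasDerivAt_pow 2 t).const_add 1)).mul (e0 t)).deriv
    refine this.trans ?_
    simp; ring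
  have h4 : deriv (fun t : ℝ => (3 * t + t ^ 3) * Real.exp (t ^ 2 / 2)) 0 = 3 := by
    have := (((((hasDerivAt_id (0:ℝ)).const_mul 3).add (hasDerivAt_pow 3 (0:ℝ)))).mul (e0 0)).deriv
    refine this.trans ?_
    simp
  have hf : (fun t : ℝ => Real.exp (0 * t + ((1 : NNReal) : ℝ) * t ^ 2 / 2))
      = fun t => Real.exp (t ^ 2 / 2) := by
    funext t; simp
  rw [hf, iteratedDeriv_succ, iteratedDeriv_succ, iteratedDeriv_succ, iteratedDeriv_one, h1, h2, h3,
    h4]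

lemma gauss_int_pow (k : ℕ) : Integrable (fun x : ℝ => x ^ k) (gaussianReal 0 1) := by
  have := (memLp_id_gaussianReal (μ := 0) (v := 1) (k : NNReal))
  have h2 := MemLp.integrable_norm_pow' (f := id) (p := k) (μ := gaussianReal 0 1) (by simpa using this)
  refine h2.mono' (by fun_prop) ?_
  filter_upwards with x
  simp

/-- characteristic function of the centred chi square -/
def chi (θ : ℝ) : ℂ := ∫ z, Complex.exp (((θ * (z ^ 2 - 1) : ℝ) : ℂ) * Complex.I) ∂(gaussianReal 0 1)

lemma norm_chi_le (θ : ℝ) : ‖chi θ‖ ≤ 1 := by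
  have := norm_integral_le_of_norm_le_const (μ := gaussianReal 0 1) (C := 1)
    (f := fun z => Complex.exp (((θ * (z ^ 2 - 1) : ℝ) : ℂ) * Complex.I))
    (by filter_upwards with z; rw [Complex.norm_exp_ofReal_mul_I])
  simpa [chi] using this

lemma chi_taylor : ∀ ε > 0, ∃ δ > 0, ∀ θ : ℝ, |θ| ≤ δ →
    ‖chi θ - Complex.exp ((-(θ ^ 2) : ℝ) : ℂ)‖ ≤ ε * θ ^ 2 := by
  set X : ℝ → ℝ := fun z => (z ^ 2 - 1) / √2 with hX
  have hs : (√2 : ℝ) ^ 2 = 2 := Real.sq_sqrt (by norm_num)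
  have hs0 : (√2 : ℝ) ≠ 0 := by positivity
  have hXm : AEMeasurable X (gaussianReal 0 1) := by fun_prop
  have h0 : (gaussianReal 0 1)[X] = 0 := by
    simp only [hX]
    rw [integral_div, integral_sub (gauss_int_pow 2) (by simp), gauss_sq]
    simp
  have h1 : (gaussianReal 0 1)[X ^ 2] = 1 := by
    have : X ^ 2 = fun z => (z ^ 4 - 2 * z ^ 2 + 1) / 2 := by
      funext z
      simp only [hX, Pi.pow_apply, div_pow, hs]
      ring
    rw [this, integral_div, integral_add, integral_sub, integral_const_mul, gauss_sq, gauss_four]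
    · simp; norm_num
    · exact gauss_int_pow 4
    · exact (gauss_int_pow 2).const_mul 2
    · exact (gauss_int_pow 4).sub ((gauss_int_pow 2).const_mul 2)
    · simp
  have ht := taylor_charFun_two hXm h0 h1
  have hchi : ∀ θ, charFun ((gaussianReal 0 1).map X) (√2 * θ) = chi θ := by
    intro θ
    rw [charFun_apply_real, integral_map hXm (by fun_prop), chi]
    congr 1
    funext z
    congr 2
    simp only [hX]
    push_cast
    have : ((√2 : ℝ) : ℂ) ≠ 0 := by exact_mod_cast hs0
    field_simp
  intro ε hε
  have h2 := ht.def (c := ε / 4) (by positivity)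
  obtain ⟨δ, hδ, hb⟩ := Metric.eventually_nhds_iff.1 h2
  refine ⟨min (δ / 2 / √2) (min 1 (√ε / 2)), by positivity, fun θ hθ => ?_⟩
  have hθ1 : |θ| ≤ δ / 2 / √2 := hθ.trans (min_le_left _ _)
  have hθ2 : |θ| ≤ 1 := hθ.trans ((min_le_right _ _).trans (min_le_left _ _))
  have hθ3 : |θ| ≤ √ε / 2 := hθ.trans ((min_le_right _ _).trans (min_le_right _ _))
  have hd : dist (√2 * θ) 0 < δ := by
    rw [Real.dist_eq, sub_zero, abs_mul, abs_of_nonneg (Real.sqrt_nonneg 2)]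
    rw [le_div_iff₀ (by positivity)] at hθ1
    linarith [mul_comm |θ| (√2)]
  have h3 := hb hd
  rw [hchi] at h3
  have hsq : θ ^ 2 ≤ ε / 4 := by
    have : |θ| ^ 2 ≤ (√ε / 2) ^ 2 := by gcongr
    rw [sq_abs, div_pow, Real.sq_sqrt hε.le] at this
    linarith
  have hsq1 : θ ^ 2 ≤ 1 := by
    have : |θ| ^ 2 ≤ (1:ℝ) ^ 2 := by gcongr
    rw [sq_abs] at this; linarith
  have e1 : ‖(((√2 * θ) ^ 2 : ℝ) : ℝ)‖ = 2 * θ ^ 2 := by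
    rw [mul_pow, hs, Real.norm_of_nonneg (by positivity)]
  have e2 : (1 : ℂ) - ((√2 * θ : ℝ) : ℂ) ^ 2 / 2 = ((1 - θ ^ 2 : ℝ) : ℂ) := by
    have : ((√2 * θ : ℝ) : ℂ) ^ 2 = ((2 * θ ^ 2 : ℝ) : ℂ) := by
      rw [← Complex.ofReal_pow, mul_pow, hs]
    rw [this]; push_cast; ring
  have e3 : ‖((1 - θ ^ 2 : ℝ) : ℂ) - Complex.exp ((-(θ ^ 2) : ℝ) : ℂ)‖ ≤ ε / 4 * θ ^ 2 := by
    rw [← Complex.ofReal_exp, ← Complex.ofReal_sub, Complex.norm_real, Real.norm_eq_abs, abs_sub_comm]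
    have := Real.abs_exp_sub_one_sub_id_le (x := -θ ^ 2) (by rw [abs_neg, abs_of_nonneg (by positivity)]; exact hsq1)
    calc _ = |Real.exp (-θ ^ 2) - 1 - -θ ^ 2| := by congr 1; ring
      _ ≤ _ := this
      _ = θ ^ 2 * θ ^ 2 := by ring
      _ ≤ _ := by gcongr
  have h3' : ‖chi θ - ((1 - θ ^ 2 : ℝ) : ℂ)‖ ≤ ε / 4 * (2 * θ ^ 2) := by
    rw [← e2, ← e1]; exact h3
  calc _ = ‖(chi θ - ((1 - θ ^ 2 : ℝ) : ℂ)) + (((1 - θ ^ 2 : ℝ) : ℂ) - Complex.exp ((-(θ ^ 2) : ℝ) : ℂ))‖ := by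
        congr 1; ring
    _ ≤ ε / 4 * (2 * θ ^ 2) + ε / 4 * θ ^ 2 := (norm_add_le _ _).trans (add_le_add h3' e3)
    _ ≤ _ := by nlinarith [sq_nonneg θ]

lemma norm_prod_sub_prod {κ : Type*} (s : Finset κ) (f g : κ → ℂ) (hf : ∀ i, ‖f i‖ ≤ 1)
    (hg : ∀ i, ‖g i‖ ≤ 1) : ‖∏ i ∈ s, f i - ∏ i ∈ s, g i‖ ≤ ∑ i ∈ s, ‖f i - g i‖ := by
  classical
  induction s using Finset.induction_on with
  | empty => simp
  | insert a s ha ih =>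
    rw [Finset.prod_insert ha, Finset.prod_insert ha, Finset.sum_insert ha]
    have hp : ‖∏ i ∈ s, f i‖ ≤ 1 := by
      rw [norm_prod]; exact Finset.prod_le_one (fun i _ => norm_nonneg _) (fun i _ => hf i)
    calc _ = ‖(f a - g a) * ∏ i ∈ s, f i + g a * (∏ i ∈ s, f i - ∏ i ∈ s, g i)‖ := by
          congr 1; ring
      _ ≤ ‖f a - g a‖ * ‖∏ i ∈ s, f i‖ + ‖g a‖ * ‖∏ i ∈ s, f i - ∏ i ∈ s, g i‖ := by
          refine (norm_add_le _ _).trans ?_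
          rw [norm_mul, norm_mul]
      _ ≤ ‖f a - g a‖ * 1 + 1 * ∑ i ∈ s, ‖f i - g i‖ := by
          gcongr
          exact hg a
      _ = _ := by ring

open Matrix in
lemma quad_charFun {n : ℕ} (M : Matrix (Fin n) (Fin n) ℝ) (hM : M.IsHermitian) (htr : M.trace = 0)
    (s : ℝ) :
    ∫ ξ, Complex.exp (((s * (ξ ⬝ᵥ M *ᵥ ξ) : ℝ) : ℂ) * Complex.I)
        ∂(Measure.pi fun _ : Fin n => gaussianReal 0 1)
      = ∏ j, chi (s * hM.eigenvalues j) := by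
  set b := hM.eigenvectorBasis with hb
  have hmap := (map_pi_eq_stdGaussian (ι := Fin n)).trans (stdGaussian_eq_map_pi_orthonormalBasis b)
  set F : EuclideanSpace ℝ (Fin n) → ℂ := fun v =>
    Complex.exp (((s * (v.ofLp ⬝ᵥ M *ᵥ v.ofLp) : ℝ) : ℂ) * Complex.I) with hF
  have hFm : Measurable F := by
    simp only [hF, dotProduct, mulVec]
    fun_prop
  have h1 : ∫ ξ, F (WithLp.toLp 2 ξ) ∂(Measure.pi fun _ : Fin n => gaussianReal 0 1)
      = ∫ x, F (∑ i, x i • b i) ∂(Measure.pi fun _ : Fin n => gaussianReal 0 1) := by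
    rw [← integral_map (φ := WithLp.toLp 2) (by fun_prop) hFm.aestronglyMeasurable, hmap,
      integral_map (Measurable.aemeasurable (by fun_prop)) hFm.aestronglyMeasurable]
  have hsum : ∑ j, hM.eigenvalues j = 0 := by
    have := hM.trace_eq_sum_eigenvalues
    rw [htr] at this
    simpa using this.symm
  have hq : ∀ x : Fin n → ℝ, (∑ i, x i • b i).ofLp ⬝ᵥ M *ᵥ (∑ i, x i • b i).ofLp
      = ∑ j, hM.eigenvalues j * (x j ^ 2 - 1) := by
    intro x
    have e1 : M *ᵥ (∑ i, x i • b i).ofLp = (∑ i, (hM.eigenvalues i * x i) • b i).ofLp := by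
      simp only [WithLp.ofLp_sum, WithLp.ofLp_smul, Matrix.mulVec_sum, Matrix.mulVec_smul]
      refine Finset.sum_congr rfl fun i _ => ?_
      rw [hM.mulVec_eigenvectorBasis i, smul_smul, mul_comm]
    have e2 : ∀ v w : EuclideanSpace ℝ (Fin n), v.ofLp ⬝ᵥ w.ofLp = inner ℝ v w := by
      intro v w
      simp [PiLp.inner_apply, dotProduct, mul_comm]
    rw [e1, e2, b.orthonormal.inner_sum]
    simp only [mul_sub, mul_one, Finset.sum_sub_distrib, hsum, sub_zero]
    refine Finset.sum_congr rfl fun i _ => ?_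
    simp; ring
  refine h1.trans ?_
  simp only [hF, hq, chi]
  rw [← integral_fintype_prod_eq_prod (𝕜 := ℂ) (fun j z => Complex.exp (((s * hM.eigenvalues j * (z ^ 2 - 1) : ℝ) : ℂ) * Complex.I))]
  congr 1
  funext x
  rw [← Complex.exp_sum, ← Finset.sum_mul, ← Complex.ofReal_sum, Finset.mul_sum]
  simp only [mul_assoc]

open Matrix in
lemma sum_sq_eigenvalues {n : ℕ} (M : Matrix (Fin n) (Fin n) ℝ) (hM : M.IsHermitian) :
    ∑ j, hM.eigenvalues j ^ 2 = ∑ i, ∑ k, M i k ^ 2 := by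
  have h1 : ∑ i, ∑ k, M i k ^ 2 = (M * M).trace := by
    simp only [Matrix.trace, Matrix.diag, Matrix.mul_apply]
    refine Finset.sum_congr rfl fun i _ => Finset.sum_congr rfl fun k _ => ?_
    have : M k i = M i k := by simpa using hM.apply i k
    rw [this, sq]
  rw [h1]
  conv_rhs => rw [hM.spectral_theorem]
  rw [← map_mul, Unitary.conjStarAlgAut_apply, Matrix.trace_mul_cycle]
  simp [Matrix.diagonal_mul_diagonal, Matrix.trace, sq]

open Matrix in
lemma quad_bound {ε δ : ℝ} (hδ : ∀ θ : ℝ, |θ| ≤ δ →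
      ‖chi θ - Complex.exp ((-(θ ^ 2) : ℝ) : ℂ)‖ ≤ ε * θ ^ 2)
    {n : ℕ} (M : Matrix (Fin n) (Fin n) ℝ) (hM : M.IsHermitian) (htr : M.trace = 0)
    (s ρ : ℝ) (hρ : ∀ v : Fin n → ℝ, ∑ i, v i ^ 2 = 1 → |v ⬝ᵥ M *ᵥ v| ≤ ρ) (hsρ : |s| * ρ ≤ δ) :
    ‖∫ ξ, Complex.exp (((s * (ξ ⬝ᵥ M *ᵥ ξ) : ℝ) : ℂ) * Complex.I)
        ∂(Measure.pi fun _ : Fin n => gaussianReal 0 1)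
      - Complex.exp ((-(s ^ 2 * ∑ i, ∑ k, M i k ^ 2) : ℝ) : ℂ)‖
      ≤ ε * s ^ 2 * ∑ i, ∑ k, M i k ^ 2 := by
  rw [quad_charFun M hM htr, ← sum_sq_eigenvalues M hM]
  have e : Complex.exp ((-(s ^ 2 * ∑ j, hM.eigenvalues j ^ 2) : ℝ) : ℂ)
      = ∏ j, Complex.exp ((-((s * hM.eigenvalues j) ^ 2) : ℝ) : ℂ) := by
    rw [← Complex.exp_sum, ← Complex.ofReal_sum, Finset.sum_neg_distrib, Finset.mul_sum]
    simp only [mul_pow]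
  rw [e]
  refine (norm_prod_sub_prod _ _ _ (fun j => norm_chi_le _) (fun j => ?_)).trans ?_
  · rw [Complex.norm_exp, Complex.ofReal_re, Real.exp_le_one_iff]
    have := sq_nonneg (s * hM.eigenvalues j)
    linarith
  · rw [Finset.mul_sum]
    refine Finset.sum_le_sum fun j _ => ?_
    refine (hδ _ ?_).trans (le_of_eq (by ring))
    rw [abs_mul]
    refine le_trans ?_ hsρ
    gcongr
    have h1 := hM.eigenvalues_eq j
    have h2 := hρ (hM.eigenvectorBasis j) (by
      have := hM.eigenvectorBasis.orthonormal.1 j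
      have h3 := EuclideanSpace.real_norm_sq_eq (hM.eigenvectorBasis j)
      rw [this] at h3
      simpa using h3.symm)
    rw [h1]
    simpa using h2
/-- centred empirical Gram matrix -/
def Emat {ι : Type*} [DecidableEq ι] {n : ℕ} (Φ : ι → Fin n → ℝ) (l m : ι) : ℝ :=
  (1 / (n : ℝ)) * ∑ i, Φ l i * Φ m i - if l = m then 1 else 0

/-- squared Frobenius norm of the centred Gram matrix -/
def Qf {ι : Type*} [Fintype ι] [DecidableEq ι] {n : ℕ} (Φ : ι → Fin n → ℝ) : ℝ :=
  ∑ l, ∑ m, Emat Φ l m ^ 2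

/-- kernel matrix -/
def Kmat {ι : Type*} [Fintype ι] {n : ℕ} (A : ι → ℝ) (Φ : ι → Fin n → ℝ) (i k : Fin n) : ℝ :=
  ∑ l, A l * Φ l i * Φ l k

/-- normalised off-diagonal kernel matrix -/
def Mmat {ι : Type*} [Fintype ι] {n : ℕ} (A : ι → ℝ) (Φ : ι → Fin n → ℝ) (u : ℝ) :
    Matrix (Fin n) (Fin n) ℝ :=
  Matrix.of fun i k => if i = k then 0 else Kmat A Φ i k / (2 * n * u)

set_option linter.unusedSectionVars false

section Det
variable {ι : Type*} [Fintype ι] [DecidableEq ι] {n : ℕ} (A : ι → ℝ) (Φ : ι → Fin n → ℝ)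

lemma gram_eq (hn : 0 < n) (l m : ι) :
    ∑ i, Φ l i * Φ m i = n * ((if l = m then 1 else 0) + Emat Φ l m) := by
  have : (n : ℝ) ≠ 0 := by positivity
  simp only [Emat]
  field_simp
  ring

lemma Qf_nonneg : 0 ≤ Qf Φ := Finset.sum_nonneg fun _ _ => Finset.sum_nonneg fun _ _ => sq_nonneg _

lemma Kmat_diag (hA : ∀ l, 0 ≤ A l) {b : ℝ} (hb : ∀ l, A l ≤ b) {N : ℝ}
    (hΦ : ∀ i, ∑ l, Φ l i ^ 2 = N) (i : Fin n) : 0 ≤ Kmat A Φ i i ∧ Kmat A Φ i i ≤ b * N := by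
  constructor
  · refine Finset.sum_nonneg fun l _ => ?_
    have := mul_nonneg (hA l) (mul_self_nonneg (Φ l i))
    linarith
  · rw [← hΦ i, Finset.mul_sum]
    refine Finset.sum_le_sum fun l _ => ?_
    have := mul_le_mul_of_nonneg_right (hb l) (mul_self_nonneg (Φ l i))
    linarith

lemma quad_eq (u : ℝ) (v : Fin n → ℝ) :
    dotProduct v ((Mmat A Φ u).mulVec v)
      = (∑ l, A l * (∑ i, Φ l i * v i) ^ 2 - ∑ i, Kmat A Φ i i * v i ^ 2) / (2 * n * u) := by
  have h1 : ∑ l, A l * (∑ i, Φ l i * v i) ^ 2 = ∑ i, ∑ k, v i * (Kmat A Φ i k * v k) := by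
    simp only [Kmat, sq, Finset.mul_sum, Finset.sum_mul]
    rw [Finset.sum_comm]
    refine Finset.sum_congr rfl fun i _ => ?_
    rw [Finset.sum_comm]
    refine Finset.sum_congr rfl fun k _ => ?_
    refine Finset.sum_congr rfl fun l _ => ?_
    ring
  rw [h1, ← Finset.sum_sub_distrib, Finset.sum_div]
  simp only [dotProduct, Matrix.mulVec, Mmat, Matrix.of_apply, Finset.mul_sum]
  refine Finset.sum_congr rfl fun i _ => ?_
  have h2 : Kmat A Φ i i * v i ^ 2 = ∑ k, if i = k then v i * (Kmat A Φ i k * v k) else 0 := by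
    rw [Finset.sum_ite_eq]; simp; ring
  rw [h2, ← Finset.sum_sub_distrib, Finset.sum_div]
  refine Finset.sum_congr rfl fun k _ => ?_
  split_ifs <;> ring

lemma W_bound (hn : 0 < n) (v : Fin n → ℝ) (hv : ∑ i, v i ^ 2 = 1) :
    ∑ l, (∑ i, Φ l i * v i) ^ 2 ≤ n * (1 + √(Qf Φ)) := by
  set w : ι → ℝ := fun l => ∑ i, Φ l i * v i with hw
  set W := ∑ l, w l ^ 2 with hW
  have hW0 : 0 ≤ W := Finset.sum_nonneg fun _ _ => sq_nonneg _
  set y : Fin n → ℝ := fun i => ∑ l, w l * Φ l i with hy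
  have e1 : W = ∑ i, v i * y i := by
    simp only [hW, hy, sq, Finset.mul_sum]
    rw [Finset.sum_comm]
    refine Finset.sum_congr rfl fun l _ => ?_
    nth_rw 2 [hw]
    simp only [Finset.mul_sum]
    refine Finset.sum_congr rfl fun i _ => ?_
    ring
  have e2 : W ^ 2 ≤ ∑ i, y i ^ 2 := by
    have := Finset.sum_mul_sq_le_sq_mul_sq Finset.univ v y
    rw [← e1, hv, one_mul] at this
    exact this
  set T := ∑ l, ∑ m, w l * w m * Emat Φ l m with hT
  have e3 : ∑ i, y i ^ 2 = n * (W + T) := by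
    have : ∑ i, y i ^ 2 = ∑ l, ∑ m, w l * w m * ∑ i, Φ l i * Φ m i := by
      simp only [hy, sq, Finset.sum_mul_sum]
      simp only [Finset.mul_sum]
      rw [Finset.sum_comm]
      refine Finset.sum_congr rfl fun i _ => ?_
      rw [Finset.sum_comm]
      refine Finset.sum_congr rfl fun k _ => ?_
      refine Finset.sum_congr rfl fun l _ => ?_
      ring
    rw [this]
    simp only [gram_eq Φ hn]
    have : W = ∑ l, ∑ m, w l * w m * (if l = m then 1 else 0) := by
      simp [hW, sq]
    rw [this, hT, ← Finset.sum_add_distrib, Finset.mul_sum]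
    refine Finset.sum_congr rfl fun l _ => ?_
    rw [← Finset.sum_add_distrib, Finset.mul_sum]
    refine Finset.sum_congr rfl fun m _ => ?_
    ring
  have e4 : T ≤ √(Qf Φ) * W := by
    have h := Finset.sum_mul_sq_le_sq_mul_sq (Finset.univ ×ˢ Finset.univ : Finset (ι × ι))
      (fun p => w p.1 * w p.2) (fun p => Emat Φ p.1 p.2)
    simp only [Finset.sum_product] at h
    have h' : T ^ 2 ≤ W ^ 2 * Qf Φ := by
      refine h.trans (le_of_eq ?_)
      rw [Qf]
      congr 1
      rw [hW, sq (∑ l, w l ^ 2), Finset.sum_mul_sum]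
      simp only [mul_pow]
    have : T ^ 2 ≤ (√(Qf Φ) * W) ^ 2 := by
      rw [mul_pow, Real.sq_sqrt (Qf_nonneg Φ)]; linarith
    exact le_of_abs_le (abs_le_of_sq_le_sq this (by positivity))
  have hnn : (0:ℝ) < n := by positivity
  by_contra! hcon
  have hWp : 0 < W := lt_of_le_of_lt (by positivity) hcon
  have : W ^ 2 ≤ n * (1 + √(Qf Φ)) * W := by
    calc W ^ 2 ≤ n * (W + T) := e2.trans e3.le
      _ ≤ n * (W + √(Qf Φ) * W) := by gcongr
      _ = _ := by ring
  nlinarith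

lemma det_op (hn : 0 < n) (hA : ∀ l, 0 ≤ A l) {b : ℝ} (hb0 : 0 ≤ b) (hb : ∀ l, A l ≤ b) {N : ℝ} (hN : 0 ≤ N)
    (hΦ : ∀ i, ∑ l, Φ l i ^ 2 = N) {u : ℝ} (hu : 0 < u) (v : Fin n → ℝ) (hv : ∑ i, v i ^ 2 = 1) :
    |dotProduct v ((Mmat A Φ u).mulVec v)| ≤ b / (2 * u) * (1 + √(Qf Φ) + N / n) := by
  have hnn : (0:ℝ) < n := by positivity
  rw [quad_eq, abs_div, abs_of_pos (by positivity : 0 < 2 * (n:ℝ) * u), div_le_iff₀ (by positivity)]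
  have hW := W_bound Φ hn v hv
  have h1 : 0 ≤ ∑ l, A l * (∑ i, Φ l i * v i) ^ 2 :=
    Finset.sum_nonneg fun l _ => mul_nonneg (hA l) (sq_nonneg _)
  have h2 : ∑ l, A l * (∑ i, Φ l i * v i) ^ 2 ≤ b * (n * (1 + √(Qf Φ))) := by
    refine le_trans ?_ (mul_le_mul_of_nonneg_left hW hb0)
    rw [Finset.mul_sum]
    exact Finset.sum_le_sum fun l _ => mul_le_mul_of_nonneg_right (hb l) (sq_nonneg _)
  have h3 : 0 ≤ ∑ i, Kmat A Φ i i * v i ^ 2 :=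
    Finset.sum_nonneg fun i _ => mul_nonneg (Kmat_diag A Φ hA hb hΦ i).1 (sq_nonneg _)
  have h4 : ∑ i, Kmat A Φ i i * v i ^ 2 ≤ b * N := by
    calc _ ≤ ∑ i, b * N * v i ^ 2 :=
          Finset.sum_le_sum fun i _ => mul_le_mul_of_nonneg_right (Kmat_diag A Φ hA hb hΦ i).2 (sq_nonneg _)
      _ = _ := by rw [← Finset.mul_sum, hv, mul_one]
  have e : b / (2 * u) * (1 + √(Qf Φ) + N / n) * (2 * n * u) = b * (n * (1 + √(Qf Φ))) + b * N := by
    field_simp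
  rw [e, abs_le]
  have : 0 ≤ b * N := by positivity
  have : 0 ≤ b * (n * (1 + √(Qf Φ))) := by positivity
  constructor <;> linarith

lemma det_var (hn : 0 < n) (hA : ∀ l, 0 ≤ A l) {b : ℝ} (hb0 : 0 ≤ b) (hb : ∀ l, A l ≤ b)
    (hΦ : ∀ i, ∑ l, Φ l i ^ 2 = (Fintype.card ι : ℝ)) {u : ℝ} (hu : 0 < u)
    (huA : u ^ 2 = (1 / 2 : ℝ) * ∑ l, A l ^ 2) :
    |∑ i, ∑ k, Mmat A Φ u i k ^ 2 - 1 / 2|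
      ≤ b ^ 2 / (4 * u ^ 2) * (2 * √(Fintype.card ι * Qf Φ) + Qf Φ + (Fintype.card ι : ℝ) ^ 2 / n) := by
  have hnn : (0:ℝ) < n := by positivity
  set N : ℝ := (Fintype.card ι : ℝ) with hN
  have h1 : ∑ i, ∑ k, Mmat A Φ u i k ^ 2
      = (∑ i, ∑ k, Kmat A Φ i k ^ 2 - ∑ i, Kmat A Φ i i ^ 2) / (2 * n * u) ^ 2 := by
    rw [← Finset.sum_sub_distrib, Finset.sum_div]
    refine Finset.sum_congr rfl fun i _ => ?_
    have h2 : Kmat A Φ i i ^ 2 = ∑ k, if i = k then Kmat A Φ i k ^ 2 else 0 := by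
      rw [Finset.sum_ite_eq]; simp
    rw [h2, ← Finset.sum_sub_distrib, Finset.sum_div]
    refine Finset.sum_congr rfl fun k _ => ?_
    simp only [Mmat, Matrix.of_apply]
    split_ifs
    · simp
    · rw [div_pow, sub_zero]
  have h2 : ∑ i, ∑ k, Kmat A Φ i k ^ 2 = ∑ l, ∑ m, A l * A m * (∑ i, Φ l i * Φ m i) ^ 2 := by
    simp only [Kmat, sq, Finset.sum_mul_sum]
    simp only [Finset.mul_sum]
    have e : ∀ f : Fin n → Fin n → ι → ι → ℝ, ∑ i, ∑ k, ∑ l, ∑ m, f i k l m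
        = ∑ l, ∑ m, ∑ i, ∑ k, f i k l m := by
      intro f
      have : ∀ i, ∑ k, ∑ l, ∑ m, f i k l m = ∑ l, ∑ m, ∑ k, f i k l m := by
        intro i
        rw [Finset.sum_comm]
        exact Finset.sum_congr rfl fun l _ => Finset.sum_comm
      simp only [this]
      rw [Finset.sum_comm]
      exact Finset.sum_congr rfl fun l _ => Finset.sum_comm
    rw [e]
    refine Finset.sum_congr rfl fun l _ => Finset.sum_congr rfl fun m _ =>
      Finset.sum_congr rfl fun i _ => Finset.sum_congr rfl fun k _ => ?_
    ring
  set D := ∑ l, A l ^ 2 * Emat Φ l l with hD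
  set R := ∑ l, ∑ m, A l * A m * Emat Φ l m ^ 2 with hR
  have h3 : ∑ l, ∑ m, A l * A m * (∑ i, Φ l i * Φ m i) ^ 2 = n ^ 2 * (∑ l, A l ^ 2 + 2 * D + R) := by
    have : ∑ l, A l ^ 2 + 2 * D + R = ∑ l, ∑ m, ((if l = m then A l ^ 2 + 2 * (A l ^ 2 * Emat Φ l l) else 0)
        + A l * A m * Emat Φ l m ^ 2) := by
      simp only [Finset.sum_add_distrib, Finset.sum_ite_eq, Finset.mem_univ, if_true, hD, hR, Finset.mul_sum]
    rw [this, Finset.mul_sum]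
    refine Finset.sum_congr rfl fun l _ => ?_
    rw [Finset.mul_sum]
    refine Finset.sum_congr rfl fun m _ => ?_
    rw [gram_eq Φ hn]
    split_ifs with h
    · subst h; ring
    · ring
  have hDb : |D| ≤ b ^ 2 * √(N * Qf Φ) := by
    have s1 : |D| ≤ b ^ 2 * ∑ l, |Emat Φ l l| := by
      rw [Finset.mul_sum]
      refine (Finset.abs_sum_le_sum_abs _ _).trans (Finset.sum_le_sum fun l _ => ?_)
      rw [abs_mul, abs_of_nonneg (sq_nonneg _)]
      have := hA l
      have := hb l
      gcongr
    refine s1.trans (mul_le_mul_of_nonneg_left ?_ (by positivity))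
    refine Real.le_sqrt_of_sq_le ?_
    have := Finset.sum_mul_sq_le_sq_mul_sq Finset.univ (fun _ : ι => (1:ℝ)) (fun l => |Emat Φ l l|)
    simp only [one_mul, one_pow, Finset.sum_const, Finset.card_univ, nsmul_eq_mul, mul_one, sq_abs] at this
    refine this.trans ?_
    rw [hN]
    gcongr
    rw [Qf]
    refine Finset.sum_le_sum fun l _ => ?_
    exact Finset.single_le_sum (f := fun m => Emat Φ l m ^ 2) (fun m _ => sq_nonneg _) (Finset.mem_univ l)
  have hR0 : 0 ≤ R := Finset.sum_nonneg fun l _ => Finset.sum_nonneg fun m _ =>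
    mul_nonneg (mul_nonneg (hA l) (hA m)) (sq_nonneg _)
  have hRb : R ≤ b ^ 2 * Qf Φ := by
    rw [Qf, Finset.mul_sum]
    refine Finset.sum_le_sum fun l _ => ?_
    rw [Finset.mul_sum]
    refine Finset.sum_le_sum fun m _ => ?_
    rw [sq b]
    have := hA l
    have := hA m
    have := hb l
    have := hb m
    gcongr
  set G := ∑ i, Kmat A Φ i i ^ 2 with hG
  have hG0 : 0 ≤ G := Finset.sum_nonneg fun _ _ => sq_nonneg _
  have hGb : G ≤ n * (b * N) ^ 2 := by
    calc G ≤ ∑ i : Fin n, (b * N) ^ 2 := Finset.sum_le_sum fun i _ => by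
          have := Kmat_diag A Φ hA hb hΦ i
          exact pow_le_pow_left₀ this.1 this.2 2
      _ = _ := by simp
  have hA2 : ∑ l, A l ^ 2 = 2 * u ^ 2 := by rw [huA]; ring
  have e : ∑ i, ∑ k, Mmat A Φ u i k ^ 2 - 1 / 2 = (2 * D + R - G / n ^ 2) / (4 * u ^ 2) := by
    rw [h1, h2, h3, hA2]
    field_simp
    ring
  rw [e, abs_div, abs_of_pos (by positivity : 0 < 4 * u ^ 2), div_le_iff₀ (by positivity)]
  have e2 : b ^ 2 / (4 * u ^ 2) * (2 * √(N * Qf Φ) + Qf Φ + N ^ 2 / n) * (4 * u ^ 2)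
      = 2 * (b ^ 2 * √(N * Qf Φ)) + b ^ 2 * Qf Φ + n * (b * N) ^ 2 / n ^ 2 := by
    field_simp
  rw [e2]
  have hG1 : 0 ≤ G / n ^ 2 := by positivity
  have hG2 : G / n ^ 2 ≤ n * (b * N) ^ 2 / n ^ 2 := by gcongr
  have hd := abs_le.1 hDb
  rw [abs_le]
  constructor <;> linarith [hd.1, hd.2]

lemma Mmat_herm (u : ℝ) : (Mmat A Φ u).IsHermitian := by
  ext i k
  simp only [Matrix.conjTranspose_apply, Mmat, Matrix.of_apply, star_trivial]
  have : Kmat A Φ k i = Kmat A Φ i k := Finset.sum_congr rfl fun l _ => by ring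
  rw [this]
  by_cases h : i = k
  · simp [h]
  · rw [if_neg h, if_neg (Ne.symm h)]

lemma Mmat_trace (u : ℝ) : (Mmat A Φ u).trace = 0 := by
  simp [Matrix.trace, Mmat]

end Det
instance uniformCube_prob (d : ℕ) : IsProbabilityMeasure (uniformCube d) := by
  constructor
  rw [uniformCube, Measure.restrict_apply_univ, Real.volume_Icc_pi]
  simp

instance designNoiseLaw_prob (d n : ℕ) : IsProbabilityMeasure (designNoiseLaw d n) := by
  unfold designNoiseLaw; infer_instance

lemma ae_cube (d : ℕ) : ∀ᵐ t ∂(uniformCube d), t ∈ Set.Icc (0 : Fin d → ℝ) 1 :=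
  ae_restrict_mem measurableSet_Icc

lemma ae_cube_pi (d n : ℕ) : ∀ᵐ t ∂(Measure.pi fun _ : Fin n => uniformCube d),
    ∀ i, t i ∈ Set.Icc (0 : Fin d → ℝ) 1 := by
  rw [ae_all_iff]
  intro i
  exact (measurePreserving_eval (fun _ : Fin n => uniformCube d) i).quasiMeasurePreserving.ae (ae_cube d)

lemma Bstat_eq {d : ℕ} {ι : Type*} [Fintype ι] [DecidableEq ι] (φ : ι → (Fin d → ℝ) → ℝ) (a : ι → ℝ)
    (n : ℕ) (u : ℝ) (ω : (Fin n → (Fin d → ℝ)) × (Fin n → ℝ)) :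
    Bstat φ a n ω / u
      = dotProduct ω.2 ((Mmat (fun l => a l ^ 2) (fun l i => φ l (ω.1 i)) u).mulVec ω.2) := by
  set f : Fin n → Fin n → ℝ := fun i k => ω.2 i * ω.2 k * ∑ l, (a l) ^ 2 * φ l (ω.1 i) * φ l (ω.1 k) with hf
  have hsymm : ∀ i k, f k i = f i k := by
    intro i k
    simp only [hf]
    rw [mul_comm (ω.2 k)]
    congr 1
    exact Finset.sum_congr rfl fun l _ => by ring
  have h := Finset.sum_sum_Ioi_add_eq_sum_sum_off_diag f
  have h1 : ∑ i, ∑ k ∈ Finset.Ioi i, (f k i + f i k) = 2 * ∑ i, ∑ k ∈ Finset.Ioi i, f i k := by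
    simp only [hsymm, Finset.mul_sum]
    refine Finset.sum_congr rfl fun i _ => Finset.sum_congr rfl fun k _ => ?_
    rw [hsymm]; ring
  rw [h1] at h
  have h2 : Bstat φ a n ω = (1 / (n:ℝ)) * ∑ i, ∑ k ∈ Finset.Ioi i, f i k := rfl
  have h3 : ∑ i, ∑ k ∈ Finset.Ioi i, f i k = (1 / 2) * ∑ i, ∑ k ∈ {i}ᶜ, f k i := by
    rw [← h]; ring
  rw [h2, h3]
  simp only [dotProduct, Matrix.mulVec, Mmat, Matrix.of_apply, Finset.mul_sum, Finset.sum_div]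
  refine Finset.sum_congr rfl fun i _ => ?_
  have : ∀ g : Fin n → ℝ, ∑ k ∈ ({i}ᶜ : Finset (Fin n)), g k = ∑ k, if i = k then 0 else g k := by
    intro g
    rw [Finset.compl_eq_univ_sdiff, Finset.sum_sdiff_eq_sub (Finset.subset_univ _), Finset.sum_singleton]
    have : ∀ k, (if i = k then 0 else g k) = g k - if i = k then g k else 0 := by
      intro k; split_ifs <;> simp
    simp only [this, Finset.sum_sub_distrib, Finset.sum_ite_eq, Finset.mem_univ, if_true]
  rw [this]
  refine Finset.sum_congr rfl fun k _ => ?_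
  rw [hsymm]
  split_ifs
  · simp
  · simp only [hf, Kmat]
    ring

section Prob
variable {d : ℕ} {ι : Type*} [Fintype ι] [DecidableEq ι] (φ : ι → (Fin d → ℝ) → ℝ)

lemma memLp_mul
    (hmeas : ∀ l, Measurable (φ l))
    (hA2 : ∀ t ∈ Set.Icc (0 : Fin d → ℝ) 1, ∑ l, (φ l t) ^ 2 = (Fintype.card ι : ℝ))
    (l m : ι) : MemLp (fun t => φ l t * φ m t) 2 (uniformCube d) := by
  refine MemLp.of_bound (by have := hmeas l; have := hmeas m; fun_prop) (Fintype.card ι : ℝ) ?_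
  filter_upwards [ae_cube d] with t ht
  have h := hA2 t ht
  have h1 : ∀ j, φ j t ^ 2 ≤ Fintype.card ι := fun j => by
    rw [← h]
    exact Finset.single_le_sum (f := fun j => φ j t ^ 2) (fun _ _ => sq_nonneg _) (Finset.mem_univ j)
  rw [Real.norm_eq_abs, abs_le]
  constructor <;> nlinarith [h1 l, h1 m, sq_nonneg (φ l t - φ m t), sq_nonneg (φ l t + φ m t)]

lemma Emat_sq
    (hmeas : ∀ l, Measurable (φ l))
    (hON : ∀ (j l : ι), ∫ t, φ j t * φ l t ∂(uniformCube d) = if j = l then (1 : ℝ) else 0)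
    (hA2 : ∀ t ∈ Set.Icc (0 : Fin d → ℝ) 1, ∑ l, (φ l t) ^ 2 = (Fintype.card ι : ℝ))
    {n : ℕ} (hn : 0 < n) (l m : ι) :
    Integrable (fun t : Fin n → (Fin d → ℝ) => Emat (fun l i => φ l (t i)) l m ^ 2)
      (Measure.pi fun _ : Fin n => uniformCube d) ∧
    ∫ t : Fin n → (Fin d → ℝ), Emat (fun l i => φ l (t i)) l m ^ 2
      ∂(Measure.pi fun _ : Fin n => uniformCube d)
      ≤ (1 / (n:ℝ)) * ∫ t, (φ l t * φ m t) ^ 2 ∂(uniformCube d) := by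
  have hnn : (0:ℝ) < n := by positivity
  have hL := memLp_mul φ hmeas hA2 l m
  set f : (Fin d → ℝ) → ℝ := fun t => φ l t * φ m t with hf
  have hLi : ∀ i : Fin n, MemLp (fun ω : Fin n → (Fin d → ℝ) => f (ω i)) 2
      (Measure.pi fun _ : Fin n => uniformCube d) := fun i =>
    hL.comp_measurePreserving (measurePreserving_eval (fun _ : Fin n => uniformCube d) i)
  have hv := variance_sum_pi (μ := fun _ : Fin n => uniformCube d) (X := fun _ : Fin n => f)
    (fun _ => hL)
  set S : (Fin n → (Fin d → ℝ)) → ℝ := ∑ i : Fin n, fun ω => f (ω i) with hS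
  have hSL : MemLp S 2 (Measure.pi fun _ : Fin n => uniformCube d) :=
    memLp_finsetSum' _ fun i _ => hLi i
  have hES : ∫ ω, S ω ∂(Measure.pi fun _ : Fin n => uniformCube d) = n * (if l = m then 1 else 0) := by
    simp only [hS, Finset.sum_apply]
    rw [integral_finsetSum _ fun i _ => (hLi i).integrable (by norm_num)]
    have : ∀ i : Fin n, ∫ ω : Fin n → (Fin d → ℝ), f (ω i) ∂(Measure.pi fun _ : Fin n => uniformCube d)
        = if l = m then 1 else 0 := fun i => by
      rw [← hON l m]
      exact (integral_comp_eval (μ := fun _ : Fin n => uniformCube d) (i := i) (f := f) hL.aestronglyMeasurable)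
    simp [this]
  have hE : ∀ t : Fin n → (Fin d → ℝ), Emat (fun l i => φ l (t i)) l m
      = (1 / (n:ℝ)) * (S t - ∫ ω, S ω ∂(Measure.pi fun _ : Fin n => uniformCube d)) := by
    intro t
    rw [hES]
    simp only [Emat, hS, Finset.sum_apply, hf]
    field_simp
  simp only [hE, mul_pow]
  constructor
  · refine Integrable.const_mul ?_ _
    exact (hSL.sub (memLp_const _)).integrable_sq
  · rw [integral_const_mul, ← variance_eq_integral hSL.aestronglyMeasurable.aemeasurable, hv]
    have hvf : Var[f; uniformCube d] ≤ ∫ t, f t ^ 2 ∂(uniformCube d) :=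
      variance_le_expectation_sq hL.aestronglyMeasurable
    simp only [Finset.sum_const, Finset.card_univ, Fintype.card_fin, nsmul_eq_mul]
    calc (1 / (n:ℝ)) ^ 2 * (n * Var[f; uniformCube d]) = (1 / (n:ℝ)) * Var[f; uniformCube d] := by
          field_simp
      _ ≤ _ := by
          simp only [hf, mul_pow] at hvf
          gcongr

lemma Qf_mean
    (hmeas : ∀ l, Measurable (φ l))
    (hON : ∀ (j l : ι), ∫ t, φ j t * φ l t ∂(uniformCube d) = if j = l then (1 : ℝ) else 0)
    (hA2 : ∀ t ∈ Set.Icc (0 : Fin d → ℝ) 1, ∑ l, (φ l t) ^ 2 = (Fintype.card ι : ℝ))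
    {n : ℕ} (hn : 0 < n) :
    Integrable (fun t : Fin n → (Fin d → ℝ) => Qf (fun l i => φ l (t i)))
      (Measure.pi fun _ : Fin n => uniformCube d) ∧
    ∫ t : Fin n → (Fin d → ℝ), Qf (fun l i => φ l (t i))
      ∂(Measure.pi fun _ : Fin n => uniformCube d) ≤ (Fintype.card ι : ℝ) ^ 2 / n := by
  have h := fun l m => Emat_sq φ hmeas hON hA2 hn l m
  constructor
  · exact integrable_finsetSum _ fun l _ => integrable_finsetSum _ fun m _ => (h l m).1
  · simp only [Qf]
    rw [integral_finsetSum _ fun l _ => integrable_finsetSum _ fun m _ => (h l m).1]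
    have e1 : ∀ l, ∫ t : Fin n → (Fin d → ℝ), ∑ m, Emat (fun l i => φ l (t i)) l m ^ 2
        ∂(Measure.pi fun _ : Fin n => uniformCube d)
        = ∑ m, ∫ t : Fin n → (Fin d → ℝ), Emat (fun l i => φ l (t i)) l m ^ 2
        ∂(Measure.pi fun _ : Fin n => uniformCube d) := fun l =>
      integral_finsetSum _ fun m _ => (h l m).1
    simp only [e1]
    have hi : ∀ l m, Integrable (fun t => (φ l t * φ m t) ^ 2) (uniformCube d) := fun l m =>
      (memLp_mul φ hmeas hA2 l m).integrable_sq
    calc _ ≤ ∑ l, ∑ m, (1 / (n:ℝ)) * ∫ t, (φ l t * φ m t) ^ 2 ∂(uniformCube d) :=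
          Finset.sum_le_sum fun l _ => Finset.sum_le_sum fun m _ => (h l m).2
      _ = (1 / (n:ℝ)) * ∫ t, ∑ l, ∑ m, (φ l t * φ m t) ^ 2 ∂(uniformCube d) := by
          rw [integral_finsetSum _ fun l _ => integrable_finsetSum _ fun m _ => hi l m, Finset.mul_sum]
          refine Finset.sum_congr rfl fun l _ => ?_
          rw [integral_finsetSum _ fun m _ => hi l m, Finset.mul_sum]
      _ = (1 / (n:ℝ)) * ∫ t, (Fintype.card ι : ℝ) ^ 2 ∂(uniformCube d) := by
          congr 1
          refine integral_congr_ae ?_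
          filter_upwards [ae_cube d] with t ht
          rw [← hA2 t ht, sq (∑ l, φ l t ^ 2), Finset.sum_mul_sum]
          simp only [mul_pow]
      _ = _ := by simp; ring

lemma Bstat_meas
    (hmeas : ∀ l, Measurable (φ l))
    (a : ι → ℝ) (n : ℕ) : Measurable (Bstat φ a n) := by
  unfold Bstat
  refine Measurable.const_mul ?_ _
  refine Finset.measurable_sum _ fun i _ => Finset.measurable_sum _ fun k _ => ?_
  refine Measurable.mul (by fun_prop) ?_
  refine Finset.measurable_sum _ fun l _ => ?_
  have := hmeas l
  fun_prop

lemma char_bound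
    (hmeas : ∀ l, Measurable (φ l))
    (hON : ∀ (j l : ι), ∫ t, φ j t * φ l t ∂(uniformCube d) = if j = l then (1 : ℝ) else 0)
    (hA2 : ∀ t ∈ Set.Icc (0 : Fin d → ℝ) 1, ∑ l, (φ l t) ^ 2 = (Fintype.card ι : ℝ))
    (a : ι → ℝ) {n : ℕ} (hn : 0 < n) {b u : ℝ} (hb0 : 0 ≤ b) (hb : ∀ l, a l ^ 2 ≤ b)
    (hu : 0 < u) (huA : u ^ 2 = (1 / 2 : ℝ) * ∑ l, (a l) ^ 4) {ε δ : ℝ} (hε : 0 ≤ ε)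
    (hδ : ∀ θ : ℝ, |θ| ≤ δ → ‖chi θ - Complex.exp ((-(θ ^ 2) : ℝ) : ℂ)‖ ≤ ε * θ ^ 2)
    (s : ℝ) {η ρ rem : ℝ} (hη : 0 < η)
    (hρ : b / (2 * u) * (1 + √η + (Fintype.card ι : ℝ) / n) ≤ ρ) (hsρ : |s| * ρ ≤ δ)
    (hrem : b ^ 2 / (4 * u ^ 2) * (2 * √(Fintype.card ι * η) + η + (Fintype.card ι : ℝ) ^ 2 / n) ≤ rem) :
    ‖charFun ((designNoiseLaw d n).map fun ω => Bstat φ a n ω / u) s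
        - Complex.exp ((-(s ^ 2 / 2) : ℝ) : ℂ)‖
      ≤ ε * s ^ 2 * (1 / 2 + rem) + s ^ 2 * rem + 2 * ((Fintype.card ι : ℝ) ^ 2 / n / η) := by
  set N : ℝ := (Fintype.card ι : ℝ) with hN
  have hN0 : 0 ≤ N := by positivity
  have hnn : (0:ℝ) < n := by positivity
  have hrem0 : 0 ≤ rem := le_trans (by positivity) hrem
  set P := (Measure.pi fun _ : Fin n => uniformCube d) with hP
  set Γ := (Measure.pi fun _ : Fin n => gaussianReal 0 1) with hΓ
  set c : ℂ := Complex.exp ((-(s ^ 2 / 2) : ℝ) : ℂ) with hc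
  set F : (Fin n → (Fin d → ℝ)) × (Fin n → ℝ) → ℂ := fun ω =>
    Complex.exp (((s * (Bstat φ a n ω / u) : ℝ) : ℂ) * Complex.I) with hF
  have hBm := Bstat_meas φ hmeas a n
  have hFm : Measurable F := by
    simp only [hF]
    fun_prop
  have hFn : ∀ ω, ‖F ω‖ ≤ 1 := fun ω => by
    simp only [hF]; rw [Complex.norm_exp_ofReal_mul_I]
  have hFi : Integrable F (P.prod Γ) :=
    Integrable.of_bound hFm.aestronglyMeasurable 1 (Eventually.of_forall hFn)
  set ψ : (Fin n → (Fin d → ℝ)) → ℂ := fun t => ∫ ξ, F (t, ξ) ∂Γ with hψ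
  have h1 : charFun ((designNoiseLaw d n).map fun ω => Bstat φ a n ω / u) s = ∫ t, ψ t ∂P := by
    rw [charFun_apply_real, integral_map (by fun_prop) (by fun_prop)]
    simp only [hψ]
    rw [← integral_prod F hFi]
    simp only [hF, designNoiseLaw]
    congr 1
    funext ω
    push_cast
    rfl
  have hψi : Integrable ψ P := hFi.integral_prod_left
  have hψn : ∀ t, ‖ψ t‖ ≤ 1 := fun t => by
    have := norm_integral_le_of_norm_le_const (μ := Γ) (C := 1) (f := fun ξ => F (t, ξ))
      (Eventually.of_forall fun ξ => hFn _)
    simpa using this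
  have hcn : ‖c‖ ≤ 1 := by
    rw [hc, Complex.norm_exp, Complex.ofReal_re, Real.exp_le_one_iff]
    have := sq_nonneg s
    linarith
  set κ := ε * s ^ 2 * (1 / 2 + rem) + s ^ 2 * rem with hκ
  have hκ0 : 0 ≤ κ := by positivity
  set Q : (Fin n → (Fin d → ℝ)) → ℝ := fun t => Qf (fun l i => φ l (t i)) with hQ
  have hgood : ∀ t : Fin n → (Fin d → ℝ), (∀ i, t i ∈ Set.Icc (0 : Fin d → ℝ) 1) → Q t < η →
      ‖ψ t - c‖ ≤ κ := by
    intro t ht hQt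
    set Φ : ι → Fin n → ℝ := fun l i => φ l (t i) with hΦd
    set A : ι → ℝ := fun l => a l ^ 2 with hAd
    have hΦ : ∀ i, ∑ l, Φ l i ^ 2 = N := fun i => hA2 (t i) (ht i)
    have hA : ∀ l, 0 ≤ A l := fun l => sq_nonneg _
    have hQt' : Qf Φ ≤ η := hQt.le
    have hQ0 := Qf_nonneg Φ
    have hop : ∀ v : Fin n → ℝ, ∑ i, v i ^ 2 = 1 →
        |dotProduct v ((Mmat A Φ u).mulVec v)| ≤ ρ := by
      intro v hv
      refine (det_op A Φ hn hA hb0 hb hN0 hΦ hu v hv).trans (le_trans ?_ hρ)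
      gcongr
    have hvar := (det_var A Φ hn hA hb0 hb hΦ hu (by rw [huA]; simp only [hAd]; congr 1; exact Finset.sum_congr rfl fun l _ => by ring)).trans
      (le_trans (by gcongr) hrem)
    set V := ∑ i, ∑ k, Mmat A Φ u i k ^ 2 with hV
    have hV0 : 0 ≤ V := Finset.sum_nonneg fun _ _ => Finset.sum_nonneg fun _ _ => sq_nonneg _
    have hqb := quad_bound hδ (Mmat A Φ u) (Mmat_herm A Φ u) (Mmat_trace A Φ u) s ρ hop hsρ
    have hψt : ψ t = ∫ ξ, Complex.exp (((s * (dotProduct ξ ((Mmat A Φ u).mulVec ξ)) : ℝ) : ℂ) * Complex.I) ∂Γ := by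
      simp only [hψ, hF, Bstat_eq]
      rfl
    rw [← hψt, ← hV] at hqb
    have hv := abs_le.1 hvar
    have hlip : ‖Complex.exp ((-(s ^ 2 * V) : ℝ) : ℂ) - c‖ ≤ s ^ 2 * rem := by
      rw [hc, ← Complex.ofReal_exp, ← Complex.ofReal_exp, ← Complex.ofReal_sub, Complex.norm_real, Real.norm_eq_abs]
      have key : ∀ x y : ℝ, 0 ≤ x → 0 ≤ y → |Real.exp (-x) - Real.exp (-y)| ≤ |x - y| := by
        have key' : ∀ x y : ℝ, 0 ≤ x → x ≤ y → |Real.exp (-x) - Real.exp (-y)| ≤ |x - y| := by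
          intro x y hx hxy
          have h1 : Real.exp (-y) ≤ Real.exp (-x) := Real.exp_le_exp.2 (by linarith)
          rw [abs_of_nonneg (by linarith), abs_of_nonpos (by linarith)]
          have h2 : Real.exp (-y) = Real.exp (-x) * Real.exp (x - y) := by
            rw [← Real.exp_add]; congr 1; ring
          have h3 := Real.add_one_le_exp (x - y)
          have h4 : Real.exp (-x) ≤ 1 := Real.exp_le_one_iff.2 (by linarith)
          have h5 := Real.exp_pos (-x)
          rw [h2]
          nlinarith
        intro x y hx hy
        rcases le_total x y with h | h
        · exact key' x y hx h
        · rw [abs_sub_comm, abs_sub_comm x]; exact key' y x hy h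
      refine (key (s ^ 2 * V) (s ^ 2 / 2) (by positivity) (by positivity)).trans ?_
      rw [show s ^ 2 * V - s ^ 2 / 2 = s ^ 2 * (V - 1 / 2) by ring, abs_mul, abs_of_nonneg (sq_nonneg s)]
      gcongr
    calc ‖ψ t - c‖ = ‖(ψ t - Complex.exp ((-(s ^ 2 * V) : ℝ) : ℂ)) + (Complex.exp ((-(s ^ 2 * V) : ℝ) : ℂ) - c)‖ := by
          congr 1; ring
      _ ≤ ε * s ^ 2 * V + s ^ 2 * rem := (norm_add_le _ _).trans (add_le_add hqb hlip)
      _ ≤ κ := by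
          rw [hκ]
          gcongr
          linarith [hv.2]
  have hQm : Measurable Q := by
    simp only [hQ, Qf, Emat]
    refine Finset.measurable_sum _ fun l _ => Finset.measurable_sum _ fun m _ => ?_
    have := hmeas l
    have := hmeas m
    fun_prop
  set Bad : Set (Fin n → (Fin d → ℝ)) := {t | η ≤ Q t} with hBad
  have hBadm : MeasurableSet Bad := measurableSet_le measurable_const hQm
  obtain ⟨hQi, hQe⟩ := Qf_mean φ hmeas hON hA2 hn
  have hmarkov : P.real Bad ≤ N ^ 2 / n / η := by
    rw [le_div_iff₀ hη, mul_comm]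
    exact (mul_meas_ge_le_integral_of_nonneg (Eventually.of_forall fun t => Qf_nonneg _) hQi η).trans hQe
  have hpt : ∀ᵐ t ∂P, ‖ψ t - c‖ ≤ κ + Bad.indicator (fun _ => (2:ℝ)) t := by
    filter_upwards [ae_cube_pi d n] with t ht
    by_cases hb' : t ∈ Bad
    · rw [Set.indicator_of_mem hb']
      have := (norm_sub_le (ψ t) c).trans (add_le_add (hψn t) hcn)
      linarith
    · rw [Set.indicator_of_notMem hb', add_zero]
      exact hgood t ht (not_le.1 hb')
  have hint : Integrable (fun t => ψ t - c) P := hψi.sub (integrable_const _)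
  have hsub : ∫ t, ψ t ∂P - c = ∫ t, (ψ t - c) ∂P := by
    rw [integral_sub hψi (integrable_const _)]; simp
  have hindi : Integrable (Bad.indicator (fun _ => (2:ℝ))) P := (integrable_const _).indicator hBadm
  rw [h1, hsub]
  calc _ ≤ ∫ t, ‖ψ t - c‖ ∂P := norm_integral_le_integral_norm _
    _ ≤ ∫ t, (κ + Bad.indicator (fun _ => (2:ℝ)) t) ∂P :=
        integral_mono_ae hint.norm ((integrable_const _).add hindi) hpt
    _ = κ + P.real Bad * 2 := by
        rw [integral_add (integrable_const _) hindi, integral_indicator_const _ hBadm]; simp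
    _ ≤ _ := by linarith

end Prob
/- STATEMENT 13 (Proposition 7.1): under the stated assumptions the degenerate
U-statistic B_n is asymptotically N(0, u_n²) with u_n² = ½ Σ_{l∈𝓝} a_l⁴, i.e.
B_n/u_n converges in distribution to N(0,1). -/
theorem stmt13 {d : ℕ} {ι : ℕ → Type*} [∀ n, Fintype (ι n)] [∀ n, DecidableEq (ι n)]
    (φ : ∀ n, ι n → (Fin d → ℝ) → ℝ)
    (hmeas : ∀ n l, Measurable (φ n l))
    (hON : ∀ n (j l : ι n),
      ∫ t, φ n j t * φ n l t ∂(uniformCube d) = if j = l then (1 : ℝ) else 0)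
    (N : ℕ → ℕ) (hNcard : ∀ n, N n = Fintype.card (ι n))
    (hNtop : Tendsto (fun n => (N n : ℝ)) atTop atTop)
    (hB1 : Tendsto (fun n => (N n : ℝ) / n) atTop (𝓝 0))
    (hA2 : ∀ n, ∀ t ∈ Set.Icc (0 : Fin d → ℝ) 1, ∑ l, (φ n l t) ^ 2 = (N n : ℝ))
    (a : ∀ n, ι n → ℝ) (ha : ∀ n l, 0 ≤ a n l)
    (ha4 : Asymp (fun n => (1 / 2 : ℝ) * ∑ l, (a n l) ^ 4) (fun _ => 1))
    (hamax : Asymp (fun n => (N n : ℝ) * ⨆ l, (a n l) ^ 4) (fun _ => 1))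
    (u : ℕ → ℝ) (hu : ∀ n, 0 < u n)
    (huval : ∀ n, (u n) ^ 2 = (1 / 2 : ℝ) * ∑ l, (a n l) ^ 4) :
    ∀ x : ℝ,
      Tendsto (fun n =>
          (designNoiseLaw d n {ω | Bstat (φ n) (a n) n ω / u n ≤ x}).toReal)
        atTop (𝓝 (stdGaussCDF x)) := by
  classical
  obtain ⟨c₁, _, hc₁, -, h4⟩ := ha4
  obtain ⟨_, C, -, hC, hmx⟩ := hamax
  set r : ℕ → ℝ := fun n => (N n : ℝ) / n with hr
  set y : ℕ → ℝ := fun n => √(√(r n)) with hy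
  have hy0 : Tendsto y atTop (𝓝 0) := by
    have := (Real.continuous_sqrt.comp Real.continuous_sqrt).tendsto 0
    simp only [Function.comp, Real.sqrt_zero] at this
    exact this.comp hB1
  have hNinv : Tendsto (fun n => √((N n : ℝ)⁻¹)) atTop (𝓝 0) := by
    have := Real.continuous_sqrt.tendsto 0
    rw [Real.sqrt_zero] at this
    exact this.comp (tendsto_inv_atTop_zero.comp hNtop)
  set ρ : ℕ → ℝ := fun n => √C / (2 * √c₁) * (√((N n : ℝ)⁻¹) + y n + r n) with hρ
  set rem : ℕ → ℝ := fun n => C / (4 * c₁) * (2 * y n + y n ^ 2 + r n) with hrem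
  have hρ0 : Tendsto ρ atTop (𝓝 0) := by
    have := ((hNinv.add hy0).add hB1).const_mul (√C / (2 * √c₁))
    rw [add_zero, add_zero, mul_zero] at this
    exact this
  have hrem0 : Tendsto rem atTop (𝓝 0) := by
    have := (((hy0.const_mul 2).add (hy0.pow 2)).add hB1).const_mul (C / (4 * c₁))
    simpa using this
  have hchar : ∀ s : ℝ, Tendsto (fun n => charFun ((designNoiseLaw d n).map
      fun ω => Bstat (φ n) (a n) n ω / u n) s) atTop (𝓝 (Complex.exp ((-(s ^ 2 / 2) : ℝ) : ℂ))) := by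
    intro s
    rw [Metric.tendsto_atTop']
    suffices H : ∀ ε > 0, ∀ᶠ n in atTop, dist (charFun ((designNoiseLaw d n).map
      fun ω => Bstat (φ n) (a n) n ω / u n) s) (Complex.exp ((-(s ^ 2 / 2) : ℝ) : ℂ)) < ε by
      intro ε hε
      obtain ⟨n0, hn0⟩ := eventually_atTop.1 (H ε hε)
      exact ⟨n0, fun n hn => hn0 n hn.le⟩
    intro ε₀ hε₀
    set ε : ℝ := ε₀ / (s ^ 2 + 1) with hε
    have hεp : 0 < ε := by positivity
    obtain ⟨δ, hδp, hδ⟩ := chi_taylor ε hεp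
    have hlim : Tendsto (fun n => ε * s ^ 2 * (1 / 2 + rem n) + s ^ 2 * rem n + 2 * y n ^ 2) atTop
        (𝓝 (ε * s ^ 2 * (1 / 2 + 0) + s ^ 2 * 0 + 2 * 0 ^ 2)) :=
      (((hrem0.const_add _).const_mul _).add (hrem0.const_mul _)).add ((hy0.pow 2).const_mul 2)
    have hlt : ε * s ^ 2 * (1 / 2 + 0) + s ^ 2 * 0 + 2 * 0 ^ 2 < ε₀ := by
      have : ε * (s ^ 2 + 1) = ε₀ := by rw [hε]; field_simp
      nlinarith [sq_nonneg s]
    have hsρ : ∀ᶠ n in atTop, |s| * ρ n < δ := by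
      have := hρ0.const_mul |s|
      rw [mul_zero] at this
      exact this.eventually_lt_const hδp
    filter_upwards [hlim.eventually_lt_const hlt, hsρ, h4, hmx, hNtop.eventually_ge_atTop 1,
      eventually_gt_atTop 0] with n hn1 hn2 hn3 hn4 hN1 hnpos
    rw [dist_eq_norm]
    refine lt_of_le_of_lt ?_ hn1
    have hnn : (0:ℝ) < n := by exact_mod_cast hnpos
    have hNp : (0:ℝ) < N n := by linarith
    have hrp : 0 < r n := by simp only [hr]; positivity
    have hyp : 0 < y n := by simp only [hy]; positivity
    have hy2 : y n ^ 2 = √(r n) := Real.sq_sqrt (Real.sqrt_nonneg _)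
    have hy4 : y n ^ 4 = r n := by
      rw [show y n ^ 4 = (y n ^ 2) ^ 2 by ring, hy2, Real.sq_sqrt hrp.le]
    have hcard : (Fintype.card (ι n) : ℝ) = N n := by rw [hNcard n]
    set b : ℝ := √(C * (N n : ℝ)⁻¹) with hb
    have hb2 : b ^ 2 = C * (N n : ℝ)⁻¹ := Real.sq_sqrt (by positivity)
    have hb' : b = √C * √((N n : ℝ)⁻¹) := by rw [hb, Real.sqrt_mul hC.le]
    have hab : ∀ l, a n l ^ 2 ≤ b := by
      intro l
      refine Real.le_sqrt_of_sq_le ?_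
      have h1 : a n l ^ 4 ≤ ⨆ l, (a n l) ^ 4 :=
        le_ciSup (f := fun l => a n l ^ 4) (Set.finite_range _).bddAbove l
      have h2 : (N n : ℝ) * a n l ^ 4 ≤ C := by
        have := mul_le_mul_of_nonneg_left h1 hNp.le
        linarith [hn4.2]
      rw [← div_eq_mul_inv, le_div_iff₀ hNp]
      linarith
    have hu2 : c₁ ≤ u n ^ 2 := by
      rw [huval n]; linarith [hn3.1]
    have hu1 : √c₁ ≤ u n := by
      rw [Real.sqrt_le_left (hu n).le]; exact hu2
    have hsc : 0 < √c₁ := Real.sqrt_pos.2 hc₁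
    have hsN : 0 < √((N n : ℝ)⁻¹) := Real.sqrt_pos.2 (by positivity)
    have hsN1 : √((N n : ℝ)⁻¹) ≤ 1 := by
      exact Real.sqrt_le_one.2 (inv_le_one_of_one_le₀ hN1)
    have hηs : √((N n : ℝ) * y n ^ 2) = √(N n : ℝ) * y n := by
      rw [Real.sqrt_mul hNp.le, Real.sqrt_sq hyp.le]
    have hNN : √((N n : ℝ)⁻¹) * √(N n : ℝ) = 1 := by
      rw [← Real.sqrt_mul (by positivity), inv_mul_cancel₀ hNp.ne', Real.sqrt_one]
    have key := char_bound (φ n) (hmeas n) (hON n) (by rw [hcard]; exact hA2 n) (a n) hnpos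
      (b := b) (u := u n) (Real.sqrt_nonneg _) hab (hu n) (huval n) hεp.le hδ s
      (η := (N n : ℝ) * y n ^ 2) (ρ := ρ n) (rem := rem n) (by positivity) ?_ hn2.le ?_
    · refine key.trans (le_of_eq ?_)
      rw [hcard]
      congr 2
      have : (N n : ℝ) ^ 2 / n = N n * y n ^ 4 := by
        rw [hy4]; simp only [hr]; ring
      rw [this]
      field_simp
    · rw [hcard, hηs]
      have e : b / (2 * u n) * (1 + √(N n : ℝ) * y n + (N n : ℝ) / n)
          = √C / (2 * u n) * (√((N n : ℝ)⁻¹) + (√((N n : ℝ)⁻¹) * √(N n : ℝ)) * y n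
            + √((N n : ℝ)⁻¹) * r n) := by
        rw [hb']; simp only [hr]; ring
      rw [e, hNN, one_mul]
      simp only [hρ]
      have : √((N n : ℝ)⁻¹) * r n ≤ r n := mul_le_of_le_one_left hrp.le hsN1
      gcongr
    · rw [hcard, hb2]
      have e1 : √((N n : ℝ) * ((N n : ℝ) * y n ^ 2)) = N n * y n := by
        rw [← mul_assoc, ← sq, ← mul_pow, Real.sqrt_sq (by positivity)]
      have e : C * (N n : ℝ)⁻¹ / (4 * u n ^ 2) * (2 * ((N n : ℝ) * y n) + (N n : ℝ) * y n ^ 2 + (N n : ℝ) ^ 2 / n)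
          = C / (4 * u n ^ 2) * (2 * y n + y n ^ 2 + r n) := by
        simp only [hr]; field_simp
      rw [e1, e]
      simp only [hrem]
      gcongr
  intro x
  have hm : ∀ n, AEMeasurable (fun ω => Bstat (φ n) (a n) n ω / u n) (designNoiseLaw d n) := fun n =>
    ((Bstat_meas (φ n) (hmeas n) (a n) n).div_const _).aemeasurable
  set μ : ℕ → ProbabilityMeasure ℝ := fun n =>
    ⟨(designNoiseLaw d n).map (fun ω => Bstat (φ n) (a n) n ω / u n),
      Measure.isProbabilityMeasure_map (hm n)⟩ with hμ
  set μ₀ : ProbabilityMeasure ℝ := ⟨gaussianReal 0 1, inferInstance⟩ with hμ₀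
  have hconv : Tendsto μ atTop (𝓝 μ₀) := by
    refine ProbabilityMeasure.tendsto_of_tendsto_charFun fun s => ?_
    have : charFun (μ₀ : Measure ℝ) s = Complex.exp ((-(s ^ 2 / 2) : ℝ) : ℂ) := by
      simp only [hμ₀, ProbabilityMeasure.coe_mk, charFun_gaussianReal]
      congr 1
      push_cast
      simp
    rw [this]
    exact hchar s
  have hfr : (μ₀ : Measure ℝ) (frontier (Set.Iic x)) = 0 := by
    have : NullSingletonClass (μ₀ : Measure ℝ) := nullSingletonClass_gaussianReal (by norm_num)
    rw [frontier_Iic]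
    exact measure_singleton x
  have h := ProbabilityMeasure.tendsto_measure_of_null_frontier_of_tendsto' hconv hfr
  have h' := (ENNReal.tendsto_toReal (measure_ne_top (μ₀ : Measure ℝ) (Set.Iic x))).comp h
  refine h'.congr fun n => ?_
  simp only [Function.comp, hμ, ProbabilityMeasure.coe_mk]
  rw [Measure.map_apply_of_aemeasurable (hm n) measurableSet_Iic]
  rfl
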